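/- arXiv:1006.1723 — 2 statements merged into one kernel-verified Lean document; each statement's English description precedes it below -/
import Mathlib

section
/- Let δ > 0, m ≥ 1, and fix real numbers 1/2 < c_1 < c_2 < ⋯ < c_m. For κ ≥ 1 and a map ι : {1,…,κ} → {1,…,m}, set γ_j = c_{ι(j)} for 1 ≤ j ≤ κ and define M(ι) = 2^κ · Σ_{P ∈ 𝒫(κ)} 2^{−#P} · δ^{#P − 2Σ_{j=1}^κ γ_j} · ∏_{B ∈ P} 1/(2·Σ_{j∈B} γ_j − 1). If μ and ν are Borel probability measures on ℝ^m such that for every κ ≥ 1 and every map ι : {1,…,κ} → {1,…,m} the joint moments exist and satisfy ∫_{ℝ^m} ∏_{j=1}^κ x_{ι(j)} dμ(x) = M(ι) and ∫_{ℝ^m} ∏_{j=1}^κ x_{ι(j)} dν(x) = M(ι), then μ = ν. (The collection of joint moments M(ι) determines a unique probability measure on ℝ^m.) -/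
open MeasureTheory

/-- A finite collection `Q` of subsets of `{1,…,κ}` is a set partition of `{1,…,κ}` if its
blocks are nonempty and every element lies in exactly one block. -/
def IsSetPartition {κ : ℕ} (Q : Finset (Finset (Fin κ))) : Prop :=
  (∀ B ∈ Q, B.Nonempty) ∧ ∀ x : Fin κ, ∃! B, B ∈ Q ∧ x ∈ B

open scoped Classical in
/-- The joint moment
`M(ι) = 2^κ ∑_{P ∈ 𝒫(κ)} 2^{-#P} δ^{#P - 2 Σ_j γ_j} ∏_{B ∈ P} (2 Σ_{j ∈ B} γ_j - 1)⁻¹`,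
where `γ_j = c_{ι(j)}`, of the random vector `(T(c_1,δ),…,T(c_m,δ))`. -/
noncomputable def jointTruncMoment (δ : ℝ) {m : ℕ} (c : Fin m → ℝ)
    (κ : ℕ) (ι : Fin κ → Fin m) : ℝ :=
  2 ^ κ * ∑ Q : Finset (Finset (Fin κ)),
    if IsSetPartition Q then
      ((2 : ℝ) ^ Q.card)⁻¹ * δ ^ ((Q.card : ℝ) - 2 * ∑ j : Fin κ, c (ι j)) *
        ∏ B ∈ Q, 1 / (2 * (∑ j ∈ B, c (ι j)) - 1)
    else 0

open ProbabilityTheory Filter Topology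

lemma aux_exp_int {Ω : Type*} [MeasurableSpace Ω] (μ : Measure Ω) [IsProbabilityMeasure μ]
    (X : Ω → ℝ) (hX : Measurable X) (A : ℝ) (hA : 0 < A)
    (hint : ∀ n : ℕ, Integrable (fun x => X x ^ n) μ)
    (hb : ∀ n : ℕ, ∫ x, X x ^ n ∂μ ≤ A ^ n * (n : ℝ) ^ n) :
    0 ∈ interior (integrableExpSet X μ) := by
  set e := Real.exp 1 with he
  have hepos : 0 < e := Real.exp_pos 1
  set t : ℝ := 1 / (2 * A * e) with ht
  have htpos : 0 < t := by positivity
  have hterm : ∀ n : ℕ, ∫ x, (t * X x) ^ (2 * n) / ((2 * n).factorial : ℝ) ∂μ ≤ (1 / 4 : ℝ) ^ n := by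
    intro n
    have h1 : ∫ x, (t * X x) ^ (2 * n) / ((2 * n).factorial : ℝ) ∂μ
        = t ^ (2 * n) / ((2 * n).factorial : ℝ) * ∫ x, X x ^ (2 * n) ∂μ := by
      rw [← integral_const_mul]
      congr 1 with x
      rw [mul_pow]; ring
    rw [h1]
    have h2 := Real.pow_div_factorial_le_exp (x := ((2 * n : ℕ) : ℝ)) (by positivity) (2 * n)
    have h3 : Real.exp ((2 * n : ℕ) : ℝ) = e ^ (2 * n) := by
      rw [he, ← Real.exp_nat_mul, mul_one]
    rw [h3] at h2
    calc t ^ (2 * n) / ((2 * n).factorial : ℝ) * ∫ x, X x ^ (2 * n) ∂μ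
        ≤ t ^ (2 * n) / ((2 * n).factorial : ℝ) * (A ^ (2 * n) * ((2 * n : ℕ) : ℝ) ^ (2 * n)) := by
          gcongr
          exact hb (2 * n)
      _ = (t * A) ^ (2 * n) * (((2 * n : ℕ) : ℝ) ^ (2 * n) / ((2 * n).factorial : ℝ)) := by
          rw [mul_pow]; ring
      _ ≤ (t * A) ^ (2 * n) * e ^ (2 * n) := by gcongr
      _ = (t * A * e) ^ (2 * n) := (mul_pow _ _ _).symm
      _ = (1 / 4 : ℝ) ^ n := by
          rw [pow_mul]
          congr 1
          rw [ht]; field_simp; norm_num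
  have hcosh : Integrable (fun x => Real.cosh (t * X x)) μ := by
    refine ⟨by fun_prop, ?_⟩
    rw [hasFiniteIntegral_iff_ofReal (ae_of_all _ fun x => (Real.cosh_pos _).le)]
    have h1 : ∀ x, ENNReal.ofReal (Real.cosh (t * X x))
        = ∑' n : ℕ, ENNReal.ofReal ((t * X x) ^ (2 * n) / ((2 * n).factorial : ℝ)) := by
      intro x
      rw [Real.cosh_eq_tsum, ENNReal.ofReal_tsum_of_nonneg]
      · intro n
        rw [pow_mul]; positivity
      · exact (Real.hasSum_cosh _).summable
    simp_rw [h1]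
    rw [lintegral_tsum (fun n => by fun_prop)]
    have h2 : ∀ n : ℕ, ∫⁻ x, ENNReal.ofReal ((t * X x) ^ (2 * n) / ((2 * n).factorial : ℝ)) ∂μ
        ≤ ENNReal.ofReal ((1 / 4 : ℝ) ^ n) := by
      intro n
      rw [← ofReal_integral_eq_lintegral_ofReal]
      · exact ENNReal.ofReal_le_ofReal (hterm n)
      · simp_rw [mul_pow]
        exact ((hint (2 * n)).const_mul _).div_const _
      · refine ae_of_all _ fun x => ?_
        simp only [Pi.zero_apply]
        rw [pow_mul]; positivity
    refine lt_of_le_of_lt (ENNReal.tsum_le_tsum h2) ?_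
    rw [← ENNReal.ofReal_tsum_of_nonneg (fun n => by positivity)
      (summable_geometric_of_lt_one (by norm_num) (by norm_num))]
    exact ENNReal.ofReal_lt_top
  rw [mem_interior_iff_mem_nhds]
  refine mem_of_superset (Ioo_mem_nhds (neg_lt_zero.2 htpos) htpos) ?_
  intro s hs
  change Integrable (fun x => Real.exp (s * X x)) μ
  refine (hcosh.const_mul 2).mono' (by fun_prop) (ae_of_all _ fun x => ?_)
  rw [Real.norm_eq_abs, abs_of_pos (Real.exp_pos _)]
  have h1 : s * X x ≤ |t * X x| := by
    calc s * X x ≤ |s * X x| := le_abs_self _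
      _ = |s| * |X x| := abs_mul _ _
      _ ≤ |t| * |X x| := by
        refine mul_le_mul_of_nonneg_right ?_ (abs_nonneg _)
        rw [abs_of_pos htpos]
        exact abs_le.2 ⟨hs.1.le, hs.2.le⟩
      _ = _ := (abs_mul _ _).symm
  calc Real.exp (s * X x) ≤ Real.exp |t * X x| := Real.exp_le_exp.2 h1
    _ ≤ 2 * Real.cosh |t * X x| := by
      rw [Real.cosh_eq]
      have := Real.exp_pos (-|t * X x|)
      linarith
    _ = _ := by rw [Real.cosh_abs]

lemma aux_map_eq {Ω : Type*} [MeasurableSpace Ω] (μ ν : Measure Ω) [IsProbabilityMeasure μ]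
    [IsProbabilityMeasure ν] (X : Ω → ℝ) (hX : Measurable X)
    (h1 : 0 ∈ interior (integrableExpSet X μ)) (h2 : 0 ∈ interior (integrableExpSet X ν))
    (hm : ∀ n : ℕ, ∫ x, X x ^ n ∂μ = ∫ x, X x ^ n ∂ν) :
    μ.map X = ν.map X := by
  set U : Set ℂ := {z | z.re ∈ interior (integrableExpSet X μ) ∩ interior (integrableExpSet X ν)}
    with hU
  have hconv : Convex ℝ U := by
    have : Convex ℝ (interior (integrableExpSet X μ) ∩ interior (integrableExpSet X ν)) :=
      (convex_integrableExpSet.interior).inter convex_integrableExpSet.interior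
    exact this.linear_preimage Complex.reLm
  have hAμ : AnalyticOnNhd ℂ (complexMGF X μ) U :=
    analyticOnNhd_complexMGF.mono fun z hz => hz.1
  have hAν : AnalyticOnNhd ℂ (complexMGF X ν) U :=
    analyticOnNhd_complexMGF.mono fun z hz => hz.2
  have h0 : (0 : ℂ) ∈ U := ⟨by simpa using h1, by simpa using h2⟩
  have hder : ∀ n, iteratedDeriv n (complexMGF X μ) 0 = iteratedDeriv n (complexMGF X ν) 0 := by
    intro n
    rw [iteratedDeriv_complexMGF h0.1, iteratedDeriv_complexMGF h0.2]
    simp only [zero_mul, Complex.exp_zero, mul_one]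
    have := hm n
    have h3 : ∀ ρ : Measure Ω, ∫ x, ((X x : ℂ)) ^ n ∂ρ = ((∫ x, X x ^ n ∂ρ : ℝ) : ℂ) := by
      intro ρ
      rw [← integral_complex_ofReal]
      simp
    rw [h3, h3, this]
  have hev : complexMGF X μ =ᶠ[𝓝 0] complexMGF X ν := by
    have p1 := (hAμ 0 h0).hasFPowerSeriesAt
    have p2 := (hAν 0 h0).hasFPowerSeriesAt
    simp_rw [hder] at p1
    have p3 := p1.sub p2
    rw [sub_self] at p3
    filter_upwards [p3.eventually_eq_zero] with z hz
    exact sub_eq_zero.1 hz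
  have heq := hAμ.eqOn_of_preconnected_of_eventuallyEq hAν hconv.isPreconnected h0 hev
  have : IsProbabilityMeasure (μ.map X) := Measure.isProbabilityMeasure_map hX.aemeasurable
  have : IsProbabilityMeasure (ν.map X) := Measure.isProbabilityMeasure_map hX.aemeasurable
  refine Measure.ext_of_charFun ?_
  ext t
  rw [← complexMGF_mul_I hX.aemeasurable, ← complexMGF_mul_I hX.aemeasurable]
  apply heq
  refine ⟨by simpa using h1, by simpa using h2⟩

open scoped Classical in
lemma aux_card (κ : ℕ) :
    ((Finset.univ.filter (fun Q : Finset (Finset (Fin κ)) => IsSetPartition Q)).card : ℝ)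
      ≤ (κ : ℝ) ^ κ := by
  let P := Finset.univ.filter (fun Q : Finset (Finset (Fin κ)) => IsSetPartition Q)
  have hex : ∀ Q : Finset (Finset (Fin κ)), ∃ f : Fin κ → Fin κ, IsSetPartition Q →
      Q = Finset.univ.image (fun x => Finset.univ.filter (fun y => f y = f x)) := by
    intro Q
    by_cases hQ : IsSetPartition Q
    · obtain ⟨hne, hu⟩ := hQ
      choose B hB hBu using hu
      simp only at hB hBu
      have hBne : ∀ x, (B x).Nonempty := fun x => ⟨x, (hB x).2⟩
      have hmem : ∀ x y, y ∈ B x → B y = B x := fun x y h => (hBu y (B x) ⟨(hB x).1, h⟩).symm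
      have hfib : ∀ x y, (B y).min' (hBne y) = (B x).min' (hBne x) ↔ y ∈ B x := by
        intro x y
        constructor
        · intro h
          have a1 := hmem y _ ((B y).min'_mem (hBne y))
          have a2 := hmem x _ ((B x).min'_mem (hBne x))
          rw [h, a2] at a1
          rw [a1]; exact (hB y).2
        · intro h
          simp only [hmem x y h]
      refine ⟨fun x => (B x).min' (hBne x), fun _ => ?_⟩
      simp only [hfib]
      ext S
      simp only [Finset.mem_image, Finset.mem_univ, true_and, Finset.filter_univ_mem]
      constructor
      · intro hS
        obtain ⟨x, hx⟩ := hne S hS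
        exact ⟨x, (hBu x S ⟨hS, hx⟩).symm⟩
      · rintro ⟨x, rfl⟩
        exact (hB x).1
    · exact ⟨id, fun h => absurd h hQ⟩
  choose f hf using hex
  have hle : P.card ≤ (Finset.univ : Finset (Fin κ → Fin κ)).card := by
    refine Finset.card_le_card_of_injOn f (fun _ _ => Finset.mem_coe.2 (Finset.mem_univ _)) ?_
    intro Q hQ R hR h
    have hQ' : IsSetPartition Q := by simpa [P] using hQ
    have hR' : IsSetPartition R := by simpa [P] using hR
    rw [hf Q hQ', hf R hR', h]
  have : (Finset.univ : Finset (Fin κ → Fin κ)).card = κ ^ κ := by simp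
  rw [this] at hle
  exact_mod_cast hle

lemma aux_card_le {κ : ℕ} (Q : Finset (Finset (Fin κ))) (hQ : IsSetPartition Q) :
    Q.card ≤ κ := by
  obtain ⟨hne, hu⟩ := hQ
  rcases Q.eq_empty_or_nonempty with rfl | ⟨B0, hB0⟩
  · simp
  have : Nonempty (Fin κ) := ⟨(hne B0 hB0).choose⟩
  choose! g hg using hne
  have : Q.card ≤ (Finset.univ : Finset (Fin κ)).card := by
    refine Finset.card_le_card_of_injOn g (fun _ _ => Finset.mem_coe.2 (Finset.mem_univ _)) ?_
    intro B hB C hC h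
    exact (hu (g B)).unique ⟨hB, hg B hB⟩ ⟨hC, h ▸ hg C hC⟩
  simpa using this

open scoped Classical in
lemma aux_bound (δ : ℝ) (hδ : 0 < δ) (m : ℕ) (c : Fin m → ℝ) (hc : ∀ i, 1 / 2 < c i) :
    ∃ C : ℝ, 0 < C ∧ ∀ (κ : ℕ) (ι : Fin κ → Fin m),
      |jointTruncMoment δ c κ ι| ≤ C ^ κ * (κ : ℝ) ^ κ := by
  set K : ℝ := 1 + ∑ i, 1 / (2 * c i - 1) with hK
  set D : ℝ := 1 + ∑ i, δ ^ (-(2 * c i)) with hD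
  have hpos : ∀ i, 0 < 1 / (2 * c i - 1) := fun i => by
    have := hc i
    apply one_div_pos.2; linarith
  have hK1 : 1 ≤ K := by
    have := Finset.sum_nonneg (s := Finset.univ) (fun i _ => (hpos i).le)
    linarith
  have hKi : ∀ i, 1 / (2 * c i - 1) ≤ K := fun i => by
    have := Finset.single_le_sum (s := Finset.univ) (fun i _ => (hpos i).le) (Finset.mem_univ i)
    linarith
  have hDpos : ∀ i, 0 < δ ^ (-(2 * c i)) := fun i => Real.rpow_pos_of_pos hδ _
  have hD1 : 1 ≤ D := by
    have := Finset.sum_nonneg (s := Finset.univ) (fun i _ => (hDpos i).le)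
    linarith
  have hDi : ∀ i, δ ^ (-(2 * c i)) ≤ D := fun i => by
    have := Finset.single_le_sum (s := Finset.univ) (fun i _ => (hDpos i).le) (Finset.mem_univ i)
    linarith
  refine ⟨2 * ((1 + δ) * D * K), by positivity, fun κ ι => ?_⟩
  have hterm : ∀ Q : Finset (Finset (Fin κ)), IsSetPartition Q →
      |((2 : ℝ) ^ Q.card)⁻¹ * δ ^ ((Q.card : ℝ) - 2 * ∑ j : Fin κ, c (ι j)) *
        ∏ B ∈ Q, 1 / (2 * (∑ j ∈ B, c (ι j)) - 1)| ≤ ((1 + δ) * D * K) ^ κ := by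
    intro Q hQ
    have hcard := aux_card_le Q hQ
    have e1 : |((2 : ℝ) ^ Q.card)⁻¹| ≤ 1 := by
      rw [abs_of_pos (by positivity)]
      exact inv_le_one_of_one_le₀ (one_le_pow₀ (by norm_num))
    have e2 : |δ ^ ((Q.card : ℝ) - 2 * ∑ j : Fin κ, c (ι j))| ≤ (1 + δ) ^ κ * D ^ κ := by
      rw [abs_of_pos (Real.rpow_pos_of_pos hδ _), sub_eq_add_neg, Real.rpow_add hδ,
        Real.rpow_natCast, Finset.mul_sum, ← Finset.sum_neg_distrib,
        Real.rpow_sum_of_pos hδ]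
      have f1 : δ ^ Q.card ≤ (1 + δ) ^ κ := by
        calc δ ^ Q.card ≤ (1 + δ) ^ Q.card := by gcongr; linarith
          _ ≤ (1 + δ) ^ κ := pow_le_pow_right₀ (by linarith) hcard
      have f2 : ∏ j : Fin κ, δ ^ (-(2 * c (ι j))) ≤ D ^ κ := by
        calc ∏ j : Fin κ, δ ^ (-(2 * c (ι j))) ≤ ∏ _j : Fin κ, D :=
              Finset.prod_le_prod (fun j _ => (hDpos _).le) (fun j _ => hDi _)
          _ = D ^ κ := by simp
      exact mul_le_mul f1 f2 (Finset.prod_nonneg fun j _ => (hDpos _).le) (by positivity)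
    have e3 : |∏ B ∈ Q, 1 / (2 * (∑ j ∈ B, c (ι j)) - 1)| ≤ K ^ κ := by
      have g : ∀ B ∈ Q, 0 ≤ 1 / (2 * (∑ j ∈ B, c (ι j)) - 1) ∧
          1 / (2 * (∑ j ∈ B, c (ι j)) - 1) ≤ K := by
        intro B hB
        obtain ⟨j, hj⟩ := hQ.1 B hB
        have h1 : c (ι j) ≤ ∑ j ∈ B, c (ι j) :=
          Finset.single_le_sum (f := fun j => c (ι j))
            (fun i _ => by have := hc (ι i); linarith) hj
        have h2 := hc (ι j)
        constructor
        · apply one_div_nonneg.2; linarith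
        · refine le_trans ?_ (hKi (ι j))
          apply one_div_le_one_div_of_le <;> linarith
      rw [abs_of_nonneg (Finset.prod_nonneg fun B hB => (g B hB).1)]
      calc _ ≤ ∏ _B ∈ Q, K := Finset.prod_le_prod (fun B hB => (g B hB).1) (fun B hB => (g B hB).2)
        _ = K ^ Q.card := by simp
        _ ≤ K ^ κ := pow_le_pow_right₀ hK1 hcard
    rw [abs_mul, abs_mul, mul_pow, mul_pow]
    refine mul_le_mul ?_ e3 (abs_nonneg _) (by positivity)
    calc _ ≤ 1 * ((1 + δ) ^ κ * D ^ κ) := mul_le_mul e1 e2 (abs_nonneg _) (by norm_num)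
      _ = _ := one_mul _
  unfold jointTruncMoment
  rw [abs_mul, abs_of_pos (by positivity : (0 : ℝ) < 2 ^ κ), mul_pow, mul_assoc]
  refine mul_le_mul_of_nonneg_left ?_ (by positivity)
  rw [← Finset.sum_filter]
  refine (Finset.abs_sum_le_sum_abs _ _).trans ?_
  refine (Finset.sum_le_card_nsmul _ _ (((1 + δ) * D * K) ^ κ) ?_).trans ?_
  · intro Q hQ
    exact hterm Q (Finset.mem_filter.1 hQ).2
  · rw [nsmul_eq_mul, mul_comm]
    exact mul_le_mul_of_nonneg_left (aux_card κ) (by positivity)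

lemma aux_moments (m : ℕ) (a : Fin m → ℝ) (M : ∀ κ : ℕ, (Fin κ → Fin m) → ℝ) (C : ℝ)
    (hC : 0 < C) (hM : ∀ (κ : ℕ) (ι : Fin κ → Fin m), |M κ ι| ≤ C ^ κ * (κ : ℝ) ^ κ)
    (μ : Measure (Fin m → ℝ)) [IsProbabilityMeasure μ]
    (hint : ∀ (κ : ℕ), 1 ≤ κ → ∀ ι : Fin κ → Fin m,
      Integrable (fun x : Fin m → ℝ => ∏ j : Fin κ, x (ι j)) μ)
    (hmom : ∀ (κ : ℕ), 1 ≤ κ → ∀ ι : Fin κ → Fin m,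
      ∫ x, ∏ j : Fin κ, x (ι j) ∂μ = M κ ι) :
    0 ∈ interior (integrableExpSet (fun x : Fin m → ℝ => ∑ i, a i * x i) μ) ∧
    ∀ n : ℕ, 1 ≤ n → ∫ x, (∑ i, a i * x i) ^ n ∂μ = ∑ ι : Fin n → Fin m, (∏ j, a (ι j)) * M n ι := by
  have hexp : ∀ n : ℕ, ∀ x : Fin m → ℝ, (∑ i, a i * x i) ^ n
      = ∑ ι : Fin n → Fin m, (∏ j, a (ι j)) * ∏ j, x (ι j) := by
    intro n x
    rw [Finset.sum_pow', Fintype.piFinset_univ]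
    simp_rw [Finset.prod_mul_distrib]
  have hI : ∀ n : ℕ, Integrable (fun x : Fin m → ℝ => (∑ i, a i * x i) ^ n) μ := by
    intro n
    rcases Nat.eq_zero_or_pos n with rfl | hn
    · simp
    · simp_rw [hexp]
      exact integrable_finsetSum _ fun ι _ => (hint n hn ι).const_mul _
  have hE : ∀ n : ℕ, 1 ≤ n → ∫ x, (∑ i, a i * x i) ^ n ∂μ
      = ∑ ι : Fin n → Fin m, (∏ j, a (ι j)) * M n ι := by
    intro n hn
    simp_rw [hexp]
    rw [integral_finsetSum _ fun ι _ => (hint n hn ι).const_mul _]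
    simp_rw [integral_const_mul, hmom n hn]
  refine ⟨?_, hE⟩
  have hS : 0 ≤ ∑ i, |a i| := Finset.sum_nonneg fun i _ => abs_nonneg _
  refine aux_exp_int μ _ (by fun_prop) ((1 + ∑ i, |a i|) * C) (by positivity) hI ?_
  intro n
  rcases Nat.eq_zero_or_pos n with rfl | hn
  · simp
  · rw [hE n hn]
    calc ∑ ι : Fin n → Fin m, (∏ j, a (ι j)) * M n ι
        ≤ ∑ ι : Fin n → Fin m, (∏ j, |a (ι j)|) * (C ^ n * (n : ℝ) ^ n) := by
          refine Finset.sum_le_sum fun ι _ => ?_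
          refine (le_abs_self _).trans ?_
          rw [abs_mul, Finset.abs_prod]
          exact mul_le_mul_of_nonneg_left (hM n ι) (Finset.prod_nonneg fun j _ => abs_nonneg _)
      _ = (∑ i, |a i|) ^ n * (C ^ n * (n : ℝ) ^ n) := by
          rw [← Finset.sum_mul, Finset.sum_pow', Fintype.piFinset_univ]
      _ ≤ (1 + ∑ i, |a i|) ^ n * (C ^ n * (n : ℝ) ^ n) := by
          gcongr; linarith
      _ = _ := by rw [mul_pow]; ring

/-- the collection of joint moments `M(ι)` of `(T(c_1,δ),…,T(c_m,δ))`
determines a unique Borel probability measure on `ℝ^m`. -/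
theorem joint_truncated_moments_determine_measure
    (δ : ℝ) (hδ : 0 < δ) (m : ℕ) (hm : 1 ≤ m)
    (c : Fin m → ℝ) (hc : ∀ i, 1 / 2 < c i) (hmono : StrictMono c)
    (μ ν : Measure (Fin m → ℝ)) [IsProbabilityMeasure μ] [IsProbabilityMeasure ν]
    (hμint : ∀ (κ : ℕ), 1 ≤ κ → ∀ ι : Fin κ → Fin m,
      Integrable (fun x : Fin m → ℝ => ∏ j : Fin κ, x (ι j)) μ)
    (hνint : ∀ (κ : ℕ), 1 ≤ κ → ∀ ι : Fin κ → Fin m,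
      Integrable (fun x : Fin m → ℝ => ∏ j : Fin κ, x (ι j)) ν)
    (hμ : ∀ (κ : ℕ), 1 ≤ κ → ∀ ι : Fin κ → Fin m,
      ∫ x, ∏ j : Fin κ, x (ι j) ∂μ = jointTruncMoment δ c κ ι)
    (hν : ∀ (κ : ℕ), 1 ≤ κ → ∀ ι : Fin κ → Fin m,
      ∫ x, ∏ j : Fin κ, x (ι j) ∂ν = jointTruncMoment δ c κ ι) :
    μ = ν := by
  obtain ⟨C, hC, hb⟩ := aux_bound δ hδ m c hc
  refine Measure.ext_of_charFunDual ?_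
  ext L
  rw [charFunDual_eq_charFun_map_one, charFunDual_eq_charFun_map_one]
  have hL : (L : (Fin m → ℝ) → ℝ) = fun x => ∑ i, L (Pi.single i 1) * x i := by
    ext x
    conv_lhs => rw [pi_eq_sum_univ' x]
    rw [map_sum]
    refine Finset.sum_congr rfl fun i _ => ?_
    rw [map_smul, smul_eq_mul, mul_comm]
  obtain ⟨i1, m1⟩ := aux_moments m (fun i => L (Pi.single i 1)) (fun κ ι => jointTruncMoment δ c κ ι)
    C hC hb μ hμint hμ
  obtain ⟨i2, m2⟩ := aux_moments m (fun i => L (Pi.single i 1)) (fun κ ι => jointTruncMoment δ c κ ι)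
    C hC hb ν hνint hν
  rw [hL]
  rw [aux_map_eq μ ν _ (by fun_prop) i1 i2 ?_]
  intro n
  rcases Nat.eq_zero_or_pos n with rfl | hn
  · simp
  · rw [m1 n hn, m2 n hn]
end

section
/- Let k ≥ 2, let c > 1/2 and δ > 0 be fixed, let q be a positive integer, and let D = (d_{ij}) be an m×k matrix with integer entries and rank m (1 ≤ m ≤ k). Let M(D) denote q^{−m} times the largest absolute value of the determinant of an m×m minor of D (so M(D) > 0). Then for every n ≥ 1: V_n^{−2kc} ∫_{ℝ^n}⋯∫_{ℝ^n} ∏_{j=1}^k f_{c,δ}( Σ_{i=1}^m (d_{ij}/q)·x_i ) dx_1⋯dx_m ≤ M(D)^{−n} · δ^{m−2kc} / (2c−1)^m. -/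
open MeasureTheory

/-- `V_n = π^{n/2} / Γ(n/2 + 1)`, the volume of the unit ball in `ℝⁿ`. -/
noncomputable def unitBallVol (n : ℕ) : ℝ :=
  Real.pi ^ ((n : ℝ) / 2) / Real.Gamma ((n : ℝ) / 2 + 1)

/-- `R_n(δ) = (δ / V_n)^{1/n}`, the radius of a ball of volume `δ` in `ℝⁿ`. -/
noncomputable def cutRadius (n : ℕ) (δ : ℝ) : ℝ :=
  (δ / unitBallVol n) ^ (1 / (n : ℝ))

/-- `f_{c,δ}(x) = |x|^{-2cn}` if `|x| > R_n(δ)`, and `0` otherwise. -/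
noncomputable def truncPower (n : ℕ) (c δ : ℝ) (x : EuclideanSpace ℝ (Fin n)) : ℝ :=
  if cutRadius n δ < ‖x‖ then ‖x‖ ^ (-(2 * c * (n : ℝ))) else 0

theorem exists_minor (k m : ℕ) (D : Matrix (Fin m) (Fin k) ℤ)
    (hrank : (D.map ((↑·) : ℤ → ℚ)).rank = m) :
    ∃ g : Fin m → Fin k, (D.submatrix id g).det ≠ 0 := by
  rw [Matrix.rank_eq_finrank_span_cols] at hrank
  obtain ⟨f, hf, -, hli⟩ := Submodule.exists_fun_fin_finrank_span_eq ℚ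
    (Set.range (D.map ((↑·) : ℤ → ℚ)).col)
  choose g hg using hf
  refine ⟨fun i => g (Fin.cast hrank.symm i), ?_⟩
  have h2 : LinearIndependent ℚ
      ((D.submatrix id (fun i => g (Fin.cast hrank.symm i))).map (Int.castRingHom ℚ)).col := by
    have := hli.comp (Fin.cast hrank.symm) (Fin.cast_injective _)
    convert! this using 1
    funext i
    simp only [Function.comp, ← hg]
    rfl
  rw [Matrix.linearIndependent_cols_iff_isUnit, Matrix.isUnit_iff_isUnit_det] at h2
  intro h0
  have h3 := h2.ne_zero
  rw [← RingHom.mapMatrix_apply, ← RingHom.map_det, h0] at h3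
  simp at h3

noncomputable def blockMap {m n : ℕ} (A : Matrix (Fin m) (Fin m) ℝ) :
    (Fin m → EuclideanSpace ℝ (Fin n)) →ₗ[ℝ] (Fin m → EuclideanSpace ℝ (Fin n)) :=
  LinearMap.pi fun j => ∑ i, A i j • LinearMap.proj i

def swapEquiv (m n : ℕ) :
    (Fin m → EuclideanSpace ℝ (Fin n)) ≃ₗ[ℝ] (Fin n → Fin m → ℝ) where
  toFun x a i := x i a
  invFun y i := WithLp.toLp 2 fun a => y a i
  left_inv x := by ext; rfl
  right_inv y := by ext; rfl
  map_add' x y := by ext; rfl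
  map_smul' x y := by ext; rfl

theorem det_blockMap {m n : ℕ} (A : Matrix (Fin m) (Fin m) ℝ) :
    LinearMap.det (blockMap (n := n) A) = A.det ^ n := by
  rw [← LinearMap.det_conj _ (swapEquiv m n)]
  have : ((swapEquiv m n : _ →ₗ[ℝ] _) ∘ₗ blockMap (n := n) A ∘ₗ ((swapEquiv m n).symm : _ →ₗ[ℝ] _))
      = LinearMap.pi fun a : Fin n => (Matrix.toLin' A.transpose).comp (LinearMap.proj a) := by
    refine LinearMap.ext fun y => ?_
    funext a j
    simp [swapEquiv, blockMap, Matrix.mulVec, dotProduct]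
  rw [this, LinearMap.det_pi]
  simp

theorem unitBallVol_pos (n : ℕ) : 0 < unitBallVol n := by
  unfold unitBallVol
  have : 0 < Real.Gamma ((n : ℝ) / 2 + 1) := Real.Gamma_pos_of_pos (by positivity)
  positivity

theorem cutRadius_pos (n : ℕ) {δ : ℝ} (hδ : 0 < δ) : 0 < cutRadius n δ :=
  Real.rpow_pos_of_pos (div_pos hδ (unitBallVol_pos n)) _

theorem cutRadius_rpow (n : ℕ) (hn : 1 ≤ n) {δ : ℝ} (hδ : 0 < δ) (t : ℝ) :
    cutRadius n δ ^ ((n : ℝ) * t) = (δ / unitBallVol n) ^ t := by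
  have h := (div_pos hδ (unitBallVol_pos n)).le
  have hn' : (n : ℝ) ≠ 0 := by positivity
  rw [cutRadius, ← Real.rpow_mul h]
  congr 1
  field_simp

theorem volume_unit_ball (n : ℕ) (hn : 1 ≤ n) :
    (volume : Measure (EuclideanSpace ℝ (Fin n))).real (Metric.ball 0 1) = unitBallVol n := by
  have : Nonempty (Fin n) := ⟨⟨0, hn⟩⟩
  have h : √Real.pi ^ n / Real.Gamma ((n : ℝ) / 2 + 1) = unitBallVol n := by
    rw [unitBallVol, Real.sqrt_eq_rpow, ← Real.rpow_natCast, ← Real.rpow_mul Real.pi_pos.le]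
    congr 2
    ring
  rw [Measure.real, EuclideanSpace.volume_ball]
  simp only [Fintype.card_fin, h, ENNReal.ofReal_one, one_pow, one_mul]
  exact ENNReal.toReal_ofReal (unitBallVol_pos n).le

theorem truncPower_nonneg (n : ℕ) (c δ : ℝ) (x : EuclideanSpace ℝ (Fin n)) :
    0 ≤ truncPower n c δ x := by
  unfold truncPower
  split_ifs
  · positivity
  · exact le_rfl

theorem truncPower_le (n : ℕ) (hn : 1 ≤ n) {c δ : ℝ} (hc : 1 / 2 < c) (hδ : 0 < δ)
    (x : EuclideanSpace ℝ (Fin n)) :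
    truncPower n c δ x ≤ (δ / unitBallVol n) ^ (-(2 * c)) := by
  rw [← cutRadius_rpow n hn hδ]
  have h := cutRadius_pos n hδ
  unfold truncPower
  split_ifs with hx
  · rw [show -(2 * c * (n : ℝ)) = n * -(2 * c) by ring]
    apply Real.rpow_le_rpow_of_nonpos h hx.le
    have : (0 : ℝ) ≤ n := by positivity
    nlinarith
  · positivity

theorem measurable_truncPower (n : ℕ) (c δ : ℝ) : Measurable (truncPower n c δ) := by
  unfold truncPower
  refine Measurable.ite (measurableSet_lt measurable_const measurable_norm) ?_ measurable_const
  exact measurable_norm.pow_const _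

theorem radial_eq (n : ℕ) (hn : 1 ≤ n) (c : ℝ) {R : ℝ} (hR : 0 < R) :
    Set.EqOn (fun y : ℝ => y ^ (n - 1) • (if R < y then y ^ (-(2 * c * (n : ℝ))) else 0))
      (Set.indicator (Set.Ioi R) fun y : ℝ => y ^ ((n : ℝ) - 1 - 2 * c * n)) (Set.Ioi 0) := by
  intro y hy
  have hy : 0 < y := hy
  by_cases h : R < y
  · simp only [h, if_true, Set.indicator, Set.mem_Ioi, smul_eq_mul]
    rw [← Real.rpow_natCast, ← Real.rpow_add hy, Nat.cast_sub hn]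
    congr 1
    push_cast
    ring
  · simp [h, Set.indicator]

theorem exponent_lt {n : ℕ} (hn : 1 ≤ n) {c : ℝ} (hc : 1 / 2 < c) :
    (n : ℝ) - 1 - 2 * c * n < -1 := by
  have : (1 : ℝ) ≤ n := by exact_mod_cast hn
  nlinarith

theorem integrable_truncPower (n : ℕ) (hn : 1 ≤ n) {c δ : ℝ} (hc : 1 / 2 < c) (hδ : 0 < δ) :
    Integrable (truncPower n c δ) := by
  have : Nonempty (Fin n) := ⟨⟨0, hn⟩⟩
  have hR := cutRadius_pos n hδ
  unfold truncPower
  rw [integrable_fun_norm_addHaar volume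
    (f := fun r : ℝ => if cutRadius n δ < r then r ^ (-(2 * c * (n : ℝ))) else 0)]
  rw [finrank_euclideanSpace_fin,
    integrableOn_congr_fun (radial_eq n hn c hR) measurableSet_Ioi]
  apply Integrable.integrableOn
  rw [integrable_indicator_iff measurableSet_Ioi]
  exact integrableOn_Ioi_rpow_of_lt (exponent_lt hn hc) hR

theorem integral_truncPower (n : ℕ) (hn : 1 ≤ n) {c δ : ℝ} (hc : 1 / 2 < c) (hδ : 0 < δ) :
    ∫ x, truncPower n c δ x =
      unitBallVol n * (δ / unitBallVol n) ^ (1 - 2 * c) / (2 * c - 1) := by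
  have : Nonempty (Fin n) := ⟨⟨0, hn⟩⟩
  have hR := cutRadius_pos n hδ
  have hn' : (0 : ℝ) < n := by positivity
  unfold truncPower
  rw [integral_fun_norm_addHaar volume
    (f := fun r : ℝ => if cutRadius n δ < r then r ^ (-(2 * c * (n : ℝ))) else 0)]
  rw [finrank_euclideanSpace_fin, setIntegral_congr_fun measurableSet_Ioi (radial_eq n hn c hR),
    setIntegral_indicator measurableSet_Ioi,
    Set.inter_eq_right.2 (Set.Ioi_subset_Ioi hR.le),
    integral_Ioi_rpow_of_lt (exponent_lt hn hc) hR, volume_unit_ball n hn,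
    show (n : ℝ) - 1 - 2 * c * n + 1 = n * (1 - 2 * c) by ring, cutRadius_rpow n hn hδ,
    nsmul_eq_mul, smul_eq_mul]
  have h1 : 2 * c - 1 ≠ 0 := by linarith
  have h2 : 1 - 2 * c ≠ 0 := by linarith
  generalize (δ / unitBallVol n) ^ (1 - 2 * c) = X
  field_simp
  ring

theorem measurable_blockMap {m n : ℕ} (A : Matrix (Fin m) (Fin m) ℝ) :
    Measurable (blockMap (n := n) A) :=
  (LinearMap.continuous_of_finiteDimensional _).measurable

theorem integral_block {m n : ℕ} (hn : 1 ≤ n) {c δ : ℝ} (hc : 1 / 2 < c) (hδ : 0 < δ)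
    (A : Matrix (Fin m) (Fin m) ℝ) (hA : A.det ≠ 0) :
    Integrable (fun x : Fin m → EuclideanSpace ℝ (Fin n) =>
        ∏ j, truncPower n c δ (∑ i, A i j • x i)) ∧
      ∫ x : Fin m → EuclideanSpace ℝ (Fin n), ∏ j, truncPower n c δ (∑ i, A i j • x i) =
        (|A.det| ^ n)⁻¹ * (∫ x, truncPower n c δ x) ^ m := by
  have hmap := Measure.map_linearMap_addHaar_eq_smul_addHaar
    (volume : Measure (Fin m → EuclideanSpace ℝ (Fin n))) (f := blockMap (n := n) A)
    (by rw [det_blockMap]; exact pow_ne_zero _ hA)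
  have hmeas : Measurable (fun y : Fin m → EuclideanSpace ℝ (Fin n) =>
      ∏ j, truncPower n c δ (y j)) :=
    Finset.measurable_prod _ fun j _ => (measurable_truncPower n c δ).comp (measurable_pi_apply j)
  have hint : Integrable (fun y : Fin m → EuclideanSpace ℝ (Fin n) =>
      ∏ j, truncPower n c δ (y j)) :=
    Integrable.fintype_prod fun _ => integrable_truncPower n hn hc hδ
  have heq : ∀ x : Fin m → EuclideanSpace ℝ (Fin n), ∏ j, truncPower n c δ (∑ i, A i j • x i) =
      (fun y : Fin m → EuclideanSpace ℝ (Fin n) => ∏ j, truncPower n c δ (y j))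
        (blockMap A x) := by
    intro x
    simp [blockMap]
  simp_rw [heq]
  constructor
  · have := (integrable_map_measure (μ := volume) (f := blockMap (n := n) A)
      hmeas.aestronglyMeasurable (measurable_blockMap A).aemeasurable).1
      (by rw [hmap]; exact hint.smul_measure ENNReal.ofReal_ne_top)
    exact this
  · rw [← integral_map (measurable_blockMap A).aemeasurable hmeas.aestronglyMeasurable, hmap,
      integral_smul_measure, integral_fintype_prod_volume_eq_pow, det_blockMap,
      ENNReal.toReal_ofReal (abs_nonneg _), Fintype.card_fin, abs_inv, abs_pow, smul_eq_mul]



/-- Rogers-type bound: for an integer `m × k` matrix `D` of rank `m` and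
`M(D) = q^{-m}` times the largest absolute value of the determinant of an `m × m` minor
of `D`, one has
`V_n^{-2kc} ∫⋯∫ ∏_j f_{c,δ}(Σ_i (d_{ij}/q) x_i) dx_1⋯dx_m ≤ M(D)^{-n} δ^{m-2kc}/(2c-1)^m`. -/
theorem rogers_integral_bound
    (k m : ℕ) (hk : 2 ≤ k) (hm1 : 1 ≤ m) (hmk : m ≤ k)
    (c δ : ℝ) (hc : 1 / 2 < c) (hδ : 0 < δ)
    (q : ℕ) (hq : 0 < q)
    (D : Matrix (Fin m) (Fin k) ℤ)
    (hrank : (D.map ((↑·) : ℤ → ℚ)).rank = m)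
    (MD : ℝ)
    (hMD : IsGreatest
      {v : ℝ | ∃ g : Fin m → Fin k, v = |((D.submatrix id g).det : ℝ)|}
      ((q : ℝ) ^ m * MD))
    (n : ℕ) (hn : 1 ≤ n) :
    unitBallVol n ^ (-(2 * (k : ℝ) * c)) *
      ∫ x : Fin m → EuclideanSpace ℝ (Fin n),
        ∏ j : Fin k, truncPower n c δ (∑ i : Fin m, ((D i j : ℝ) / (q : ℝ)) • x i)
    ≤ MD ^ (-(n : ℤ)) * δ ^ ((m : ℝ) - 2 * (k : ℝ) * c) / (2 * c - 1) ^ m := by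
  have hqR : (0 : ℝ) < q := by exact_mod_cast hq
  have hV := unitBallVol_pos n
  obtain ⟨g, hg⟩ := hMD.1
  obtain ⟨g', hg'⟩ := exists_minor k m D hrank
  have hMpos : 0 < (q : ℝ) ^ m * MD := by
    refine lt_of_lt_of_le ?_ (hMD.2 ⟨g', rfl⟩)
    exact abs_pos.2 (by exact_mod_cast hg')
  have hMD0 : 0 < MD := pos_of_mul_pos_right hMpos (by positivity)
  have hdet0 : (D.submatrix id g).det ≠ 0 := by
    intro h0
    rw [hg, h0] at hMpos
    simp at hMpos
  have hginj : Function.Injective g := by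
    intro a b hab
    by_contra hne
    refine hdet0 (Matrix.det_zero_of_column_eq hne fun i => ?_)
    simp [hab]
  set A : Matrix (Fin m) (Fin m) ℝ := Matrix.of fun i j => (D i (g j) : ℝ) / (q : ℝ) with hAdef
  have hAdet : |A.det| = MD := by
    have h1 : A = (q : ℝ)⁻¹ • ((D.submatrix id g).map (Int.castRingHom ℝ)) := by
      ext i j
      simp [hAdef, div_eq_inv_mul]
    rw [h1, Matrix.det_smul, ← RingHom.mapMatrix_apply, ← RingHom.map_det, Fintype.card_fin,
      abs_mul, abs_of_pos (by positivity : 0 < (q : ℝ)⁻¹ ^ m), eq_intCast, ← hg,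
      ← mul_assoc, ← mul_pow, inv_mul_cancel₀ hqR.ne', one_pow, one_mul]
  have hA0 : A.det ≠ 0 := by
    intro h
    rw [h, abs_zero] at hAdet
    exact hMD0.ne hAdet
  obtain ⟨hint, hval⟩ := integral_block (n := n) hn hc hδ A hA0
  set B : ℝ := (δ / unitBallVol n) ^ (-(2 * c)) with hB
  have hδV : 0 < δ / unitBallVol n := div_pos hδ hV
  have hB0 : 0 < B := Real.rpow_pos_of_pos hδV _
  have hpt : ∀ x : Fin m → EuclideanSpace ℝ (Fin n),
      ∏ j : Fin k, truncPower n c δ (∑ i : Fin m, ((D i j : ℝ) / (q : ℝ)) • x i) ≤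
      B ^ (k - m) * ∏ j, truncPower n c δ (∑ i, A i j • x i) := by
    intro x
    rw [← Finset.prod_compl_mul_prod (Finset.univ.image g)]
    rw [Finset.prod_image fun a _ b _ h => hginj h]
    refine mul_le_mul_of_nonneg_right ?_ (Finset.prod_nonneg fun _ _ => truncPower_nonneg _ _ _ _)
    refine (Finset.prod_le_prod (fun _ _ => truncPower_nonneg _ _ _ _)
      (fun _ _ => truncPower_le n hn hc hδ _)).trans ?_
    rw [Finset.prod_const, Finset.card_compl, Finset.card_image_of_injective _ hginj]
    simp [hB]
  have hle : ∫ x : Fin m → EuclideanSpace ℝ (Fin n),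
        ∏ j : Fin k, truncPower n c δ (∑ i : Fin m, ((D i j : ℝ) / (q : ℝ)) • x i) ≤
      B ^ (k - m) * ((MD ^ n)⁻¹ *
        (unitBallVol n * (δ / unitBallVol n) ^ (1 - 2 * c) / (2 * c - 1)) ^ m) := by
    refine (integral_mono_of_nonneg
      (.of_forall fun x => Finset.prod_nonneg fun _ _ => truncPower_nonneg _ _ _ _)
      (hint.const_mul _) (.of_forall hpt)).trans ?_
    rw [integral_const_mul, hval, hAdet, integral_truncPower n hn hc hδ]
  refine (mul_le_mul_of_nonneg_left hle (Real.rpow_nonneg hV.le _)).trans (le_of_eq ?_)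
  have hB1 : B ^ (k - m) = (δ / unitBallVol n) ^ (-(2 * c) * ((k : ℝ) - m)) := by
    rw [hB, ← Real.rpow_natCast, ← Real.rpow_mul hδV.le, Nat.cast_sub hmk]
  have hB2 : ((δ / unitBallVol n) ^ (1 - 2 * c)) ^ m
      = (δ / unitBallVol n) ^ ((1 - 2 * c) * (m : ℝ)) := by
    rw [← Real.rpow_natCast, ← Real.rpow_mul hδV.le]
  have hB3 : B ^ (k - m) * ((δ / unitBallVol n) ^ (1 - 2 * c)) ^ m
      = δ ^ ((m : ℝ) - 2 * (k : ℝ) * c) * unitBallVol n ^ (2 * (k : ℝ) * c - m) := by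
    rw [hB1, hB2, ← Real.rpow_add hδV, Real.div_rpow hδ.le hV.le, div_eq_mul_inv,
      ← Real.rpow_neg hV.le]
    congr 2 <;> ring
  have hB4 : unitBallVol n ^ (-(2 * (k : ℝ) * c)) * unitBallVol n ^ m *
      unitBallVol n ^ (2 * (k : ℝ) * c - m) = 1 := by
    rw [← Real.rpow_natCast, ← Real.rpow_add hV, ← Real.rpow_add hV]
    ring_nf
    exact Real.rpow_zero _
  rw [div_pow, mul_pow, zpow_neg, zpow_natCast]
  calc _ = (unitBallVol n ^ (-(2 * (k : ℝ) * c)) * unitBallVol n ^ m) * (MD ^ n)⁻¹ *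
        (B ^ (k - m) * ((δ / unitBallVol n) ^ (1 - 2 * c)) ^ m) / (2 * c - 1) ^ m := by ring
    _ = (unitBallVol n ^ (-(2 * (k : ℝ) * c)) * unitBallVol n ^ m *
      unitBallVol n ^ (2 * (k : ℝ) * c - m)) * ((MD ^ n)⁻¹ *
        δ ^ ((m : ℝ) - 2 * (k : ℝ) * c) / (2 * c - 1) ^ m) := by rw [hB3]; ring
    _ = _ := by rw [hB4, one_mul]
end
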